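/- arXiv:1011.0319 — 2 statements merged into one kernel-verified Lean document; each statement's English description precedes it below -/
import Mathlib

section
/- Let q ≥ 3 and let h > 0 with (β,h) not on the critical line h_T. Then the function f_{β,h} has a unique global minimum point on the simplex ℋ. -/
open Finset

noncomputable section

namespace CWP

/-- The probability simplex ℋ in ℝ^q. -/
def simplexH (q : ℕ) : Set (Fin q → ℝ) :=
  {x | (∑ i, x i) = 1 ∧ ∀ i, 0 ≤ x i}

/-- The free-energy functional f_{β,h} of the Curie-Weiss-Potts model. -/
def fFE (q : ℕ) [NeZero q] (β h : ℝ) (x : Fin q → ℝ) : ℝ :=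
  (∑ i, x i * Real.log (q * x i)) - β / 2 * (∑ i, x i ^ 2) - h * x 0

/-- The set of global minimum points of f_{β,h} on the simplex ℋ. -/
def minSetF (q : ℕ) [NeZero q] (β h : ℝ) : Set (Fin q → ℝ) :=
  {x | x ∈ simplexH q ∧ ∀ y ∈ simplexH q, fFE q β h x ≤ fFE q β h y}

/-- h₀ = log(q-1) - 2(q-2)/q. -/
def h0 (q : ℕ) : ℝ := Real.log ((q : ℝ) - 1) - 2 * ((q : ℝ) - 2) / q

/-- The critical line h_T. -/
def onCriticalLine (q : ℕ) (β h : ℝ) : Prop :=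
  0 ≤ h ∧ h < h0 q ∧ h = Real.log ((q : ℝ) - 1) - β * ((q : ℝ) - 2) / (2 * ((q : ℝ) - 1))

/-! ### One-variable lemmas -/

/-- The one-site energy. -/
def psi (β u : ℝ) : ℝ := u * Real.log u - β / 2 * u ^ 2

lemma psi_continuous (β : ℝ) : Continuous (psi β) := by
  unfold psi
  exact Real.continuous_mul_log.sub (by fun_prop)

lemma psi_hasDeriv (β u : ℝ) (hu : u ≠ 0) :
    HasDerivAt (psi β) (Real.log u + 1 - β * u) u := by
  unfold psi
  have h1 := Real.hasDerivAt_mul_log hu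
  have h2 := ((hasDerivAt_id u).pow 2).const_mul (β / 2)
  refine (h1.sub h2).congr_deriv ?_
  simp
  ring

lemma log_diff_gt {u v : ℝ} (hu : 0 < u) (huv : u < v) :
    (v - u) / v < Real.log v - Real.log u := by
  have hv : 0 < v := hu.trans huv
  have := Real.log_lt_sub_one_of_pos (div_pos hu hv) (by
    intro h; rw [div_eq_one_iff_eq hv.ne'] at h; linarith)
  rw [Real.log_div hu.ne' hv.ne'] at this
  have e : (v - u) / v = 1 - u / v := by field_simp
  rw [e]; linarith

lemma log_diff_lt {u v : ℝ} (hu : 0 < u) (huv : u < v) :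
    Real.log v - Real.log u < (v - u) / u := by
  have hv : 0 < v := hu.trans huv
  have := Real.log_lt_sub_one_of_pos (div_pos hv hu) (by
    intro h; rw [div_eq_one_iff_eq hu.ne'] at h; linarith)
  rw [Real.log_div hv.ne' hu.ne'] at this
  have e : (v - u) / u = v / u - 1 := by field_simp
  rw [e]; linarith

lemma psi_convex (β b : ℝ) (hβ : 0 ≤ β) (hb : β * b ≤ 1) :
    StrictConvexOn ℝ (Set.Icc 0 b) (psi β) := by
  apply StrictMonoOn.strictConvexOn_of_deriv (convex_Icc 0 b) (psi_continuous β).continuousOn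
  rw [interior_Icc]
  intro u hu v hv huv
  rw [(psi_hasDeriv β u hu.1.ne').deriv, (psi_hasDeriv β v hv.1.ne').deriv]
  have h1 := log_diff_gt hu.1 huv
  have hv0 := hv.1
  have h2 : β * (v - u) ≤ (v - u) / v := by
    rw [le_div_iff₀ hv0]
    have : β * v ≤ 1 := (mul_le_mul_of_nonneg_left hv.2.le hβ).trans hb
    nlinarith
  linarith

lemma psi_concave (β a : ℝ) (ha : 0 < a) (hβ : 0 ≤ β) (hb : 1 ≤ β * a) :
    StrictConcaveOn ℝ (Set.Ici a) (psi β) := by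
  apply StrictAntiOn.strictConcaveOn_of_deriv (convex_Ici a) (psi_continuous β).continuousOn
  rw [interior_Ici]
  intro u hu v hv huv
  have hu0 : 0 < u := ha.trans hu
  have hv0 : 0 < v := ha.trans hv
  rw [(psi_hasDeriv β u hu0.ne').deriv, (psi_hasDeriv β v hv0.ne').deriv]
  have h1 := log_diff_lt hu0 huv
  have h2 : (v - u) / u ≤ β * (v - u) := by
    rw [div_le_iff₀ hu0]
    have : 1 ≤ β * u := hb.trans (mul_le_mul_of_nonneg_left (le_of_lt hu) hβ)
    nlinarith
  linarith

/-- The reduced free energy. -/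
def W (γ c s : ℝ) : ℝ :=
  s * Real.log s + (1 - s) * Real.log (1 - s) - γ / 2 * (s - 1 / 2) ^ 2 - c * s

lemma W_continuous (γ c : ℝ) : Continuous (W γ c) := by
  unfold W
  have h1 : Continuous fun s : ℝ => (1 - s) * Real.log (1 - s) :=
    Real.continuous_mul_log.comp (by fun_prop : Continuous fun s : ℝ => 1 - s)
  exact ((Real.continuous_mul_log.add h1).sub (by fun_prop)).sub (by fun_prop)

lemma W_hasDeriv (γ c s : ℝ) (h0 : 0 < s) (h1 : s < 1) :
    HasDerivAt (W γ c) (Real.log s - Real.log (1 - s) - γ * (s - 1 / 2) - c) s := by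
  unfold W
  have e1 := Real.hasDerivAt_mul_log h0.ne'
  have e0 : HasDerivAt (fun s : ℝ => 1 - s) (-1) s := by
    simpa using (hasDerivAt_id s).const_sub 1
  have e2 := (Real.hasDerivAt_mul_log (x := 1 - s) (by linarith)).comp s e0
  have e3 := (((hasDerivAt_id s).sub_const (1 / 2)).pow 2).const_mul (γ / 2)
  have e4 := (hasDerivAt_id s).const_mul c
  refine (((e1.add e2).sub e3).sub e4).congr_deriv ?_
  simp
  ring

lemma W_hasDeriv2 (γ c s : ℝ) (h0 : 0 < s) (h1 : s < 1) :
    HasDerivAt (fun s => Real.log s - Real.log (1 - s) - γ * (s - 1 / 2) - c)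
      (1 / (s * (1 - s)) - γ) s := by
  have h2 : 0 < 1 - s := by linarith
  have e1 := Real.hasDerivAt_log h0.ne'
  have e0 : HasDerivAt (fun s : ℝ => 1 - s) (-1) s := by
    simpa using (hasDerivAt_id s).const_sub 1
  have e2 := (Real.hasDerivAt_log (x := 1 - s) h2.ne').comp s e0
  have e3 := ((hasDerivAt_id s).sub_const (1 / 2)).const_mul γ
  refine (((e1.sub e2).sub e3).sub_const c).congr_deriv ?_
  field_simp
  ring

lemma W_deriv2 (γ c s : ℝ) (h0 : 0 < s) (h1 : s < 1) :
    deriv^[2] (W γ c) s = 1 / (s * (1 - s)) - γ := by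
  simp only [Function.iterate_succ, Function.iterate_zero, Function.comp, id]
  have : deriv (W γ c) =ᶠ[nhds s]
      (fun s => Real.log s - Real.log (1 - s) - γ * (s - 1 / 2) - c) := by
    filter_upwards [Ioo_mem_nhds h0 h1] with t ht
    exact (W_hasDeriv γ c t ht.1 ht.2).deriv
  rw [this.deriv_eq, (W_hasDeriv2 γ c s h0 h1).deriv]

lemma W_symm (γ c s : ℝ) : W γ c (1 - s) = W γ (-c) s - c := by
  unfold W
  have : 1 - (1 - s) = s := by ring
  rw [this]; ring

/-- Minimizers of `W` over the unit interval. -/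
def IsMinW (γ c s : ℝ) : Prop :=
  s ∈ Set.Icc (0 : ℝ) 1 ∧ ∀ t ∈ Set.Icc (0 : ℝ) 1, W γ c s ≤ W γ c t

lemma unique_of_convexOn {γ c a b s t : ℝ} (h : StrictConvexOn ℝ (Set.Icc a b) (W γ c))
    (ha : 0 ≤ a) (hb : b ≤ 1)
    (hs : IsMinW γ c s) (ht : IsMinW γ c t) (hs' : s ∈ Set.Icc a b) (ht' : t ∈ Set.Icc a b) :
    s = t := by
  by_contra hne
  have := h.2 hs' ht' hne (by norm_num : (0 : ℝ) < 1 / 2) (by norm_num : (0 : ℝ) < 1 / 2) (by norm_num)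
  have h1 := hs.2 t ht.1
  have h3 := hs.2 ((1 / 2 : ℝ) • s + (1 / 2 : ℝ) • t)
    ⟨by simp only [smul_eq_mul]; linarith [hs.1.1, ht.1.1],
      by simp only [smul_eq_mul]; linarith [hs.1.2, ht.1.2]⟩
  have h2 := ht.2 s hs.1
  simp only [smul_eq_mul] at this h3
  linarith

lemma W_unique_small {γ c s t : ℝ} (hγ : γ ≤ 4)
    (hs : IsMinW γ c s) (ht : IsMinW γ c t) : s = t := by
  refine unique_of_convexOn (a := 0) (b := 1) ?_ le_rfl le_rfl hs ht hs.1 ht.1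
  apply StrictMonoOn.strictConvexOn_of_deriv (convex_Icc 0 1) (W_continuous γ c).continuousOn
  rw [interior_Icc]
  have hd : ∀ u v : ℝ, 0 < u → u < v → v < 1 → (1 / 2 ≤ u ∨ v ≤ 1 / 2) →
      deriv (W γ c) u < deriv (W γ c) v := by
    intro u v hu huv hv hc
    have hsub : Set.Icc u v ⊆ Set.Ioo 0 1 := fun z hz => ⟨hu.trans_le hz.1, hz.2.trans_lt hv⟩
    have : StrictMonoOn (fun s => Real.log s - Real.log (1 - s) - γ * (s - 1 / 2) - c)
        (Set.Icc u v) := by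
      apply strictMonoOn_of_deriv_pos (convex_Icc u v)
      · intro z hz
        exact (W_hasDeriv2 γ c z (hsub hz).1 (hsub hz).2).continuousAt.continuousWithinAt
      · rw [interior_Icc]
        intro z hz
        have hz' := hsub (Set.Ioo_subset_Icc_self hz)
        rw [(W_hasDeriv2 γ c z hz'.1 hz'.2).deriv]
        have hp : 0 < z * (1 - z) := mul_pos hz'.1 (by linarith [hz'.2])
        have hne : z - 1 / 2 ≠ 0 := by
          rcases hc with hc | hc
          · have := hz.1; intro h; linarith
          · have := hz.2; intro h; linarith
        have hq : 0 < (z - 1 / 2) ^ 2 := by positivity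
        have : 4 < 1 / (z * (1 - z)) := by
          rw [lt_div_iff₀ hp]; nlinarith
        linarith
    have := this (Set.left_mem_Icc.2 huv.le) (Set.right_mem_Icc.2 huv.le) huv
    rw [(W_hasDeriv γ c u hu (huv.trans hv)).deriv, (W_hasDeriv γ c v (hu.trans huv) hv).deriv]
    exact this
  intro u hu v hv huv
  rcases le_or_gt (1 / 2) u with h | h
  · exact hd u v hu.1 huv hv.2 (Or.inl h)
  · rcases le_or_gt v (1 / 2) with h' | h'
    · exact hd u v hu.1 huv hv.2 (Or.inr h')
    · exact (hd u (1 / 2) hu.1 h (by norm_num) (Or.inr le_rfl)).trans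
        (hd (1 / 2) v (by norm_num) h' hv.2 (Or.inl le_rfl))

lemma W_unique_pos {γ c s t : ℝ} (hγ : 4 < γ) (hc : 0 < c)
    (hs : IsMinW γ c s) (ht : IsMinW γ c t) : s = t := by
  obtain ⟨a, ha, ha1, hae⟩ : ∃ a : ℝ, 1 / 2 < a ∧ a < 1 ∧ γ * (a * (1 - a)) = 1 := by
    have hg : 0 < 1 / 4 - 1 / γ := by
      have : 1 / γ < 1 / 4 := one_div_lt_one_div_of_lt (by norm_num) hγ
      linarith
    have hg' : 0 < 1 / γ := by positivity
    have hsq := Real.sq_sqrt hg.le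
    have hpos := Real.sqrt_pos.2 hg
    refine ⟨1 / 2 + √(1 / 4 - 1 / γ), by linarith, ?_, ?_⟩
    · have : √(1 / 4 - 1 / γ) < 1 / 2 := by nlinarith
      linarith
    · have : (1 / 2 + √(1 / 4 - 1 / γ)) * (1 - (1 / 2 + √(1 / 4 - 1 / γ))) = 1 / γ := by
        nlinarith
      rw [this]; field_simp
  have hconv : StrictConvexOn ℝ (Set.Icc a 1) (W γ c) := by
    apply strictConvexOn_of_deriv2_pos (convex_Icc a 1) (W_continuous γ c).continuousOn
    rw [interior_Icc]
    intro z hz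
    have hz0 : 0 < z := by linarith [hz.1]
    rw [W_deriv2 γ c z hz0 hz.2]
    have hp : 0 < z * (1 - z) := mul_pos hz0 (by linarith [hz.2])
    have : γ < 1 / (z * (1 - z)) := by
      rw [lt_div_iff₀ hp, ← hae]
      have := hz.1
      apply mul_lt_mul_of_pos_left _ (by linarith)
      nlinarith
    linarith
  have hanti' : AntitoneOn (fun s => Real.log s - Real.log (1 - s) - γ * (s - 1 / 2) - c)
      (Set.Icc (1 / 2) a) := by
    have hsub : ∀ z ∈ Set.Icc (1 / 2) a, 0 < z ∧ z < 1 := fun z hz =>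
      ⟨by linarith [hz.1], by linarith [hz.2]⟩
    apply antitoneOn_of_deriv_nonpos (convex_Icc _ _)
    · intro z hz
      exact (W_hasDeriv2 γ c z (hsub z hz).1 (hsub z hz).2).continuousAt.continuousWithinAt
    · rw [interior_Icc]
      intro z hz
      have hz' := hsub z (Set.Ioo_subset_Icc_self hz)
      exact (W_hasDeriv2 γ c z hz'.1 hz'.2).differentiableAt.differentiableWithinAt
    · rw [interior_Icc]
      intro z hz
      have hz' := hsub z (Set.Ioo_subset_Icc_self hz)
      rw [(W_hasDeriv2 γ c z hz'.1 hz'.2).deriv]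
      have hp : 0 < z * (1 - z) := mul_pos hz'.1 (by linarith [hz'.2])
      have : 1 / (z * (1 - z)) ≤ γ := by
        rw [div_le_iff₀ hp, ← hae]
        have := hz.1
        have := hz.2
        apply mul_le_mul_of_nonneg_left _ (by linarith)
        nlinarith
      linarith
  have hanti : StrictAntiOn (W γ c) (Set.Icc (1 / 2) a) := by
    apply strictAntiOn_of_deriv_neg (convex_Icc _ _) (W_continuous γ c).continuousOn
    rw [interior_Icc]
    intro z hz
    rw [(W_hasDeriv γ c z (by linarith [hz.1]) (by linarith [hz.2])).deriv]
    have := hanti' (Set.left_mem_Icc.2 ha.le) (Set.Ioo_subset_Icc_self hz) hz.1.le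
    have e : Real.log (1 / 2 : ℝ) - Real.log (1 - 1 / 2) = 0 := by norm_num
    simp only at this
    linarith
  have key : ∀ r, IsMinW γ c r → r ∈ Set.Icc a 1 := by
    intro r hr
    refine ⟨?_, hr.1.2⟩
    by_contra hlt
    push Not at hlt
    rcases lt_or_ge r (1 / 2) with h | h
    · have h1 := hr.2 (1 - r) ⟨by linarith [hr.1.2], by linarith [hr.1.1]⟩
      rw [W_symm] at h1
      unfold W at h1
      nlinarith
    · have := hanti ⟨h, hlt.le⟩ (Set.right_mem_Icc.2 ha.le) hlt
      have := hr.2 a ⟨by linarith, ha1.le⟩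
      linarith
  exact unique_of_convexOn hconv (by linarith) le_rfl hs ht (key s hs) (key t ht)

lemma IsMinW.symm {γ c s : ℝ} (hs : IsMinW γ c s) : IsMinW γ (-c) (1 - s) := by
  refine ⟨⟨by linarith [hs.1.2], by linarith [hs.1.1]⟩, fun t ht => ?_⟩
  have := hs.2 (1 - t) ⟨by linarith [ht.2], by linarith [ht.1]⟩
  rw [W_symm] at this ⊢
  rw [neg_neg]
  linarith

lemma W_unique {γ c s t : ℝ} (hγ : c = 0 → γ ≤ 4)
    (hs : IsMinW γ c s) (ht : IsMinW γ c t) : s = t := by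
  rcases le_or_gt γ 4 with h | h
  · exact W_unique_small h hs ht
  · rcases lt_trichotomy c 0 with hc | hc | hc
    · have := W_unique_pos h (by linarith : 0 < -c) hs.symm ht.symm
      linarith
    · exact absurd (hγ hc) (not_le.2 h)
    · exact W_unique_pos h hc hs ht

/-! ### The functional on the simplex -/

lemma fFE_eq (q : ℕ) [NeZero q] (β h : ℝ) (x : Fin q → ℝ) (hx : x ∈ simplexH q) :
    fFE q β h x = (∑ i, psi β (x i)) - h * x 0 + Real.log q := by
  have hq0 : (q : ℝ) ≠ 0 := Nat.cast_ne_zero.2 (NeZero.ne q)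
  have e : ∀ i, x i * Real.log (q * x i) = x i * Real.log (x i) + Real.log q * x i := by
    intro i
    by_cases hi : x i = 0
    · simp [hi]
    · rw [Real.log_mul hq0 hi]; ring
  unfold fFE psi
  simp only [e, Finset.sum_add_distrib, Finset.sum_sub_distrib, ← Finset.mul_sum, hx.1]
  ring

/-- Replace two coordinates. -/
def upd {q : ℕ} (x : Fin q → ℝ) (i j : Fin q) (a b : ℝ) : Fin q → ℝ :=
  Function.update (Function.update x i a) j b

lemma sum_upd {q : ℕ} (x : Fin q → ℝ) {i j : Fin q} (hij : i ≠ j) (a b : ℝ) (g : ℝ → ℝ) :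
    ∑ k, g (upd x i j a b k) = (∑ k, g (x k)) - g (x i) - g (x j) + g a + g b := by
  have h1 : ∀ (y : Fin q → ℝ) (l : Fin q) (r : ℝ),
      ∑ k, g (Function.update y l r k) = (∑ k, g (y k)) - g (y l) + g r := by
    intro y l r
    rw [← Finset.add_sum_erase _ _ (Finset.mem_univ l),
      ← Finset.add_sum_erase _ (fun k => g (y k)) (Finset.mem_univ l)]
    have : ∑ k ∈ Finset.univ.erase l, g (Function.update y l r k)
        = ∑ k ∈ Finset.univ.erase l, g (y k) := by
      apply Finset.sum_congr rfl
      intro k hk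
      rw [Function.update_of_ne (Finset.ne_of_mem_erase hk)]
    rw [this]
    simp
    ring
  unfold upd
  rw [h1, h1, Function.update_of_ne hij.symm]
  ring

lemma upd_mem {q : ℕ} {x : Fin q → ℝ} (hx : x ∈ simplexH q) {i j : Fin q} (hij : i ≠ j)
    {a b : ℝ} (ha : 0 ≤ a) (hb : 0 ≤ b) (hab : a + b = x i + x j) :
    upd x i j a b ∈ simplexH q := by
  constructor
  · have := sum_upd x hij a b id
    simp only [id] at this
    rw [this, hx.1]; linarith
  · intro k
    unfold upd
    by_cases hkj : k = j
    · subst hkj; simpa using hb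
    · rw [Function.update_of_ne hkj]
      by_cases hki : k = i
      · subst hki; simpa using ha
      · rw [Function.update_of_ne hki]; exact hx.2 k

/-- Comparison of a minimizer with a two-coordinate change away from coordinate `0`. -/
lemma cmp_off {q : ℕ} [NeZero q] {β h : ℝ} {x : Fin q → ℝ} (hx : x ∈ minSetF q β h)
    {i j : Fin q} (hij : i ≠ j) (hi : i ≠ 0) (hj : j ≠ 0)
    {a b : ℝ} (ha : 0 ≤ a) (hb : 0 ≤ b) (hab : a + b = x i + x j) :
    psi β (x i) + psi β (x j) ≤ psi β a + psi β b := by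
  have hm := upd_mem hx.1 hij ha hb hab
  have := hx.2 _ hm
  rw [fFE_eq q β h x hx.1, fFE_eq q β h _ hm, sum_upd x hij] at this
  have e : upd x i j a b 0 = x 0 := by
    unfold upd
    rw [Function.update_of_ne hj.symm, Function.update_of_ne hi.symm]
  rw [e] at this
  linarith

lemma cmp_zero {q : ℕ} [NeZero q] {β h : ℝ} {x : Fin q → ℝ} (hx : x ∈ minSetF q β h)
    {j : Fin q} (hj : j ≠ 0)
    {a b : ℝ} (ha : 0 ≤ a) (hb : 0 ≤ b) (hab : a + b = x 0 + x j) :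
    psi β (x 0) + psi β (x j) - h * x 0 ≤ psi β a + psi β b - h * a := by
  have hm := upd_mem hx.1 hj.symm ha hb hab
  have := hx.2 _ hm
  rw [fFE_eq q β h x hx.1, fFE_eq q β h _ hm, sum_upd x hj.symm] at this
  have e : upd x 0 j a b 0 = a := by
    unfold upd
    rw [Function.update_of_ne hj.symm]; simp
  rw [e] at this
  linarith

lemma zero_ge {q : ℕ} [NeZero q] {β h : ℝ} (hh : 0 < h) {x : Fin q → ℝ}
    (hx : x ∈ minSetF q β h) {j : Fin q} (hj : j ≠ 0) : x j ≤ x 0 := by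
  have := cmp_zero hx hj (hx.1.2 j) (hx.1.2 0) (add_comm _ _)
  by_contra hlt
  push Not at hlt
  nlinarith

lemma not_gt {q : ℕ} [NeZero q] {β h : ℝ} (hβ : 0 ≤ β) (hh : 0 < h) {x : Fin q → ℝ}
    (hx : x ∈ minSetF q β h) {i j : Fin q} (hi : i ≠ 0) (hj : j ≠ 0) : x i ≤ x j := by
  by_contra hlt
  push Not at hlt
  have hij : i ≠ j := by rintro rfl; exact lt_irrefl _ hlt
  have hj0 := hx.1.2 j
  have hi0 : 0 < x i := hj0.trans_lt hlt
  rcases le_or_gt (β * x i) 1 with hc | hc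
  · have h1 := (psi_convex β (x i) hβ hc).2 ⟨hi0.le, le_rfl⟩ ⟨hj0, hlt.le⟩ hlt.ne'
      (by norm_num : (0 : ℝ) < 1 / 2) (by norm_num : (0 : ℝ) < 1 / 2) (by norm_num)
    simp only [smul_eq_mul] at h1
    have h2 := cmp_off hx hij hi hj (a := 1 / 2 * x i + 1 / 2 * x j)
      (b := 1 / 2 * x i + 1 / 2 * x j) (by linarith) (by linarith) (by ring)
    linarith
  · have hβ0 : 0 < β := by
      rcases hβ.lt_or_eq with h | h
      · exact h
      · rw [← h] at hc; norm_num at hc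
    have hx0 := zero_ge hh hx hi
    have hlow : 1 / β < x i := by rw [div_lt_iff₀ hβ0]; linarith
    have hbp : 0 < 1 / β := by positivity
    set d := x i - 1 / β with hd
    have hdpos : 0 < d := by linarith
    have hconc := psi_concave β (1 / β) hbp hβ (by field_simp; exact le_rfl)
    have mid : ∀ u : ℝ, x i ≤ u → psi β (u + d) + psi β (u - d) < 2 * psi β u := by
      intro u hu
      have h1 := hconc.2 (show u + d ∈ Set.Ici (1 / β) by simp only [Set.mem_Ici]; linarith)
        (show u - d ∈ Set.Ici (1 / β) by simp only [Set.mem_Ici]; linarith)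
        (by intro h; linarith)
        (by norm_num : (0 : ℝ) < 1 / 2) (by norm_num : (0 : ℝ) < 1 / 2) (by norm_num)
      simp only [smul_eq_mul] at h1
      have e : 1 / 2 * (u + d) + 1 / 2 * (u - d) = u := by ring
      rw [e] at h1
      linarith
    have m1 := mid (x 0) hx0
    have m2 := mid (x i) le_rfl
    have c1 := cmp_zero hx hi (a := x 0 + d) (b := x i - d) (by linarith) (by linarith) (by ring)
    have c2 := cmp_zero hx hi (a := x 0 - d) (b := x i + d) (by linarith) (by linarith) (by ring)
    linarith

/-- The symmetric configuration. -/
def conf (q : ℕ) [NeZero q] (s : ℝ) : Fin q → ℝ :=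
  fun k => if k = 0 then s else (1 - s) / ((q : ℝ) - 1)

lemma sum_conf (q : ℕ) [NeZero q] (s : ℝ) (g : ℝ → ℝ) :
    ∑ k, g (conf q s k) = g s + ((q : ℝ) - 1) * g ((1 - s) / ((q : ℝ) - 1)) := by
  rw [← Finset.add_sum_erase _ _ (Finset.mem_univ (0 : Fin q))]
  have : ∑ k ∈ Finset.univ.erase (0 : Fin q), g (conf q s k)
      = ∑ k ∈ Finset.univ.erase (0 : Fin q), g ((1 - s) / ((q : ℝ) - 1)) := by
    apply Finset.sum_congr rfl
    intro k hk
    simp [conf, Finset.ne_of_mem_erase hk]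
  rw [this, Finset.sum_const, Finset.card_erase_of_mem (Finset.mem_univ _), Finset.card_univ,
    Fintype.card_fin, nsmul_eq_mul, Nat.cast_sub (NeZero.one_le)]
  simp [conf]

lemma conf_mem (q : ℕ) [NeZero q] (hq : 3 ≤ q) {s : ℝ} (hs : s ∈ Set.Icc (0 : ℝ) 1) :
    conf q s ∈ simplexH q := by
  have hq' : (3 : ℝ) ≤ q := by exact_mod_cast hq
  have hq1 : 0 < (q : ℝ) - 1 := by linarith
  constructor
  · have := sum_conf q s id
    simp only [id] at this
    rw [this]; field_simp; ring
  · intro k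
    unfold conf
    split_ifs
    · exact hs.1
    · exact div_nonneg (by linarith [hs.2]) hq1.le

lemma fFE_conf (q : ℕ) [NeZero q] (hq : 3 ≤ q) (β h : ℝ) :
    ∃ K : ℝ, ∀ s ∈ Set.Icc (0 : ℝ) 1, fFE q β h (conf q s) =
      W (β * q / (q - 1)) (β * (q - 2) / (2 * (q - 1)) + h - Real.log ((q : ℝ) - 1)) s + K := by
  have hq' : (3 : ℝ) ≤ q := by exact_mod_cast hq
  have hq1 : 0 < (q : ℝ) - 1 := by linarith
  refine ⟨Real.log q - Real.log ((q : ℝ) - 1) - β / (2 * (q - 1)) + β * q / (q - 1) / 8, ?_⟩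
  intro s hs
  rw [fFE_eq q β h _ (conf_mem q hq hs), sum_conf]
  have e : (1 - s) / ((q : ℝ) - 1) * Real.log ((1 - s) / ((q : ℝ) - 1))
      = ((1 - s) * Real.log (1 - s) - (1 - s) * Real.log ((q : ℝ) - 1)) / (q - 1) := by
    by_cases h1 : 1 - s = 0
    · simp [h1]
    · rw [Real.log_div h1 hq1.ne']; ring
  have e0 : conf q s 0 = s := by simp [conf]
  unfold psi W
  rw [e, e0]
  field_simp
  ring

lemma eq_conf {q : ℕ} [NeZero q] (hq : 3 ≤ q) {β h : ℝ} (hβ : 0 ≤ β) (hh : 0 < h)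
    {x : Fin q → ℝ} (hx : x ∈ minSetF q β h) : x = conf q (x 0) := by
  have hq' : (3 : ℝ) ≤ q := by exact_mod_cast hq
  have hq1 : 0 < (q : ℝ) - 1 := by linarith
  funext k
  by_cases hk : k = 0
  · simp [conf, hk]
  · have hs := hx.1.1
    rw [← Finset.add_sum_erase _ _ (Finset.mem_univ (0 : Fin q))] at hs
    have : ∑ j ∈ Finset.univ.erase (0 : Fin q), x j
        = ∑ j ∈ Finset.univ.erase (0 : Fin q), x k := by
      apply Finset.sum_congr rfl
      intro j hj
      exact le_antisymm (not_gt hβ hh hx (Finset.ne_of_mem_erase hj) hk)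
        (not_gt hβ hh hx hk (Finset.ne_of_mem_erase hj))
    rw [this, Finset.sum_const, Finset.card_erase_of_mem (Finset.mem_univ _), Finset.card_univ,
      Fintype.card_fin, nsmul_eq_mul, Nat.cast_sub (NeZero.one_le)] at hs
    simp only [conf, hk, if_false]
    rw [eq_div_iff hq1.ne']
    push_cast at hs
    linarith

lemma exists_min (q : ℕ) [NeZero q] (β h : ℝ) : ∃ x, x ∈ minSetF q β h := by
  have hcpt : IsCompact (simplexH q) := by
    have : simplexH q = stdSimplex ℝ (Fin q) := by
      ext x; simp only [simplexH, stdSimplex, Set.mem_ofPred_eq]; exact and_comm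
    rw [this]; exact isCompact_stdSimplex ℝ (Fin q)
  have hne : (simplexH q).Nonempty := by
    refine ⟨Pi.single 0 1, ?_, ?_⟩
    · simp
    · intro i
      by_cases hi : i = 0
      · subst hi; simp
      · simp [Pi.single_eq_of_ne hi]
  have hc : Continuous fun x : Fin q → ℝ => (∑ i, psi β (x i)) - h * x 0 + Real.log q := by
    have : Continuous fun x : Fin q → ℝ => ∑ i, psi β (x i) :=
      continuous_finsetSum _ fun i _ => (psi_continuous β).comp (continuous_apply i)
    exact (this.sub (by fun_prop)).add continuous_const
  obtain ⟨x, hx, hmin⟩ := hcpt.exists_isMinOn hne hc.continuousOn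
  refine ⟨x, hx, fun y hy => ?_⟩
  rw [fFE_eq q β h x hx, fFE_eq q β h y hy]
  exact hmin hy

/-- If h > 0 and (β,h) is not on the critical line, f_{β,h} has a unique global
minimum point on the simplex ℋ. -/
theorem stmt_0 (q : ℕ) [NeZero q] (hq : 3 ≤ q) (β h : ℝ) (hβ : 0 ≤ β) (hh : 0 < h)
    (hline : ¬ onCriticalLine q β h) :
    ∃! x : Fin q → ℝ, x ∈ minSetF q β h := by
  have hq' : (3 : ℝ) ≤ q := by exact_mod_cast hq
  have hq1 : 0 < (q : ℝ) - 1 := by linarith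
  have hq0 : 0 < (q : ℝ) := by linarith
  obtain ⟨x, hx⟩ := exists_min q β h
  refine ⟨x, hx, fun y hy => ?_⟩
  obtain ⟨K, hK⟩ := fFE_conf q hq β h
  have key : ∀ z, z ∈ minSetF q β h → IsMinW (β * q / (q - 1))
      (β * (q - 2) / (2 * (q - 1)) + h - Real.log ((q : ℝ) - 1)) (z 0) := by
    intro z hz
    have hz1 : z 0 ∈ Set.Icc (0 : ℝ) 1 := by
      refine ⟨hz.1.2 0, ?_⟩
      rw [← hz.1.1]
      exact Finset.single_le_sum (fun i _ => hz.1.2 i) (Finset.mem_univ 0)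
    refine ⟨hz1, fun t ht => ?_⟩
    have := hz.2 _ (conf_mem q hq ht)
    rw [eq_conf hq hβ hh hz, hK t ht, hK (z 0) hz1] at this
    linarith
  have h0 : y 0 = x 0 := by
    refine W_unique ?_ (key y hy) (key x hx)
    intro hc
    by_contra hg
    push Not at hg
    apply hline
    refine ⟨hh.le, ?_, by linarith⟩
    unfold CWP.h0
    have : 2 * ((q : ℝ) - 2) / q < β * ((q : ℝ) - 2) / (2 * (q - 1)) := by
      rw [lt_div_iff₀ hq1] at hg
      rw [div_lt_div_iff₀ hq0 (by linarith)]
      nlinarith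
    linarith
  rw [eq_conf hq hβ hh hy, eq_conf hq hβ hh hx, h0]

end CWP
end
end

section
/- Let q ≥ 3, β > 0 and h ≥ 0, and let x ∈ ℝ^q be a global minimum point of G_{β,h}. Then: (1) the value min_{1≤i≤q} x_i occurs among the coordinates of x at least q−1 times; (2) if h > 0 then x_1 > x_i for all i ∈ {2,…,q}; (3) min_{1≤i≤q} x_i > 0; and (4) min_{1≤i≤q} x_i < 1/β. -/
open Finset

noncomputable section

namespace CWP

/-- The function G_{β,h}. -/
def G (q : ℕ) [NeZero q] (β h : ℝ) (u : Fin q → ℝ) : ℝ :=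
  β / 2 * (∑ i, u i ^ 2) -
    Real.log (∑ k, Real.exp (β * u k + if k = 0 then h else 0))

lemma cosh_lower (y : ℝ) : 1 + y ^ 2 / 2 ≤ Real.cosh y := by
  have h1 := Real.cosh_sq (y / 2)
  have h2 := Real.cosh_two_mul (y / 2)
  have h3 : (y / 2) ^ 2 ≤ Real.sinh (y / 2) ^ 2 := by
    rw [sq_le_sq]
    rcases le_total 0 (y / 2) with h | h
    · have := Real.self_le_sinh_iff.2 h
      rw [abs_of_nonneg h, abs_of_nonneg (h.trans this)]; exact this
    · have := Real.sinh_le_self_iff.2 h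
      rw [abs_of_nonpos h, abs_of_nonpos (this.trans h)]; linarith
  rw [show 2 * (y / 2) = y by ring] at h2
  nlinarith

lemma key0 (q : ℕ) [NeZero q] (β h : ℝ) (x : Fin q → ℝ) (hx : ∀ y, G q β h x ≤ G q β h y)
    (v : Fin q → ℝ) :
    ∑ k, Real.exp (β * x k + if k = 0 then h else 0) * Real.exp (β * v k) ≤
      (∑ k, Real.exp (β * x k + if k = 0 then h else 0)) *
        Real.exp (β * (∑ k, x k * v k) + β / 2 * ∑ k, v k ^ 2) := by
  have h1 := hx (fun k => x k + v k)
  unfold G at h1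
  have e1 : ∑ k, Real.exp (β * (x k + v k) + if k = 0 then h else 0) =
      ∑ k, Real.exp (β * x k + if k = 0 then h else 0) * Real.exp (β * v k) := by
    refine Finset.sum_congr rfl fun k _ => ?_
    rw [← Real.exp_add]; congr 1; ring
  have e2 : ∑ k, (x k + v k) ^ 2 = ∑ k, x k ^ 2 + 2 * (∑ k, x k * v k) + ∑ k, v k ^ 2 := by
    rw [Finset.mul_sum, ← Finset.sum_add_distrib, ← Finset.sum_add_distrib]
    exact Finset.sum_congr rfl fun k _ => by ring
  rw [e1, e2] at h1
  have p1 : 0 < ∑ k : Fin q, Real.exp (β * x k + if k = 0 then h else 0) :=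
    Finset.sum_pos (fun _ _ => Real.exp_pos _) Finset.univ_nonempty
  have p2 : 0 < ∑ k : Fin q, Real.exp (β * x k + if k = 0 then h else 0) * Real.exp (β * v k) :=
    Finset.sum_pos (fun _ _ => by positivity) Finset.univ_nonempty
  rw [← Real.log_le_log_iff p2 (by positivity), Real.log_mul p1.ne' (Real.exp_pos _).ne',
    Real.log_exp]
  nlinarith

lemma crit (q : ℕ) [NeZero q] (β h : ℝ) (hβ : 0 < β) (x : Fin q → ℝ)
    (hx : ∀ y, G q β h x ≤ G q β h y) (i : Fin q) :
    (∑ k, Real.exp (β * x k + if k = 0 then h else 0)) * x i =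
      Real.exp (β * x i + if i = 0 then h else 0) := by
  set w : Fin q → ℝ := fun k => Real.exp (β * x k + if k = 0 then h else 0) with hw
  set Z := ∑ k, w k with hZ
  have hZp : 0 < Z := Finset.sum_pos (fun _ _ => Real.exp_pos _) Finset.univ_nonempty
  let v : Fin q → ℝ := fun k => w k / Z - x k
  have hk := key0 q β h x hx v
  change ∑ k, w k * Real.exp (β * v k) ≤ Z * _ at hk
  -- Jensen
  set m := ∑ k, w k * v k / Z with hm
  have hj : Z * Real.exp (β * m) ≤ ∑ k, w k * Real.exp (β * v k) := by
    have : ∀ k ∈ Finset.univ, Real.exp (β * m) * (w k * (1 + β * (v k - m))) ≤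
        w k * Real.exp (β * v k) := by
      intro k _
      have a : Real.exp (β * v k) = Real.exp (β * m) * Real.exp (β * (v k - m)) := by
        rw [← Real.exp_add]; congr 1; ring
      have b := Real.add_one_le_exp (β * (v k - m))
      have c : 0 < w k := Real.exp_pos _
      rw [a, mul_left_comm (w k)]
      gcongr
      linarith
    have h2 := Finset.sum_le_sum this
    refine le_trans (le_of_eq ?_) h2
    rw [← Finset.mul_sum]
    have : ∑ k, w k * (1 + β * (v k - m)) = Z := by
      have e : ∑ k, w k * (1 + β * (v k - m)) = Z + β * (Z * m) - β * m * Z := by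
        rw [hm, Finset.mul_sum, Finset.mul_sum, ← hm, hZ, Finset.mul_sum, ← hZ,
          ← Finset.sum_add_distrib, ← Finset.sum_sub_distrib]
        refine Finset.sum_congr rfl fun k _ => ?_
        field_simp
        ring
      rw [e]; ring
    rw [this]; ring
  have h3 := le_of_mul_le_mul_left (hj.trans hk) hZp
  rw [Real.exp_le_exp] at h3
  have h4 : m = ∑ k, x k * v k + ∑ k, v k ^ 2 := by
    rw [hm, ← Finset.sum_add_distrib]
    refine Finset.sum_congr rfl fun k _ => ?_
    simp only [v]; ring
  have h5 : ∑ k, v k ^ 2 ≤ 0 := by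
    rw [h4] at h3
    nlinarith
  have h6 : v i ^ 2 ≤ ∑ k, v k ^ 2 :=
    Finset.single_le_sum (f := fun k => v k ^ 2) (fun k _ => sq_nonneg _) (Finset.mem_univ i)
  have h7 : v i = 0 := by
    have := sq_nonneg (v i)
    exact pow_eq_zero_iff (two_ne_zero) |>.1 (by linarith)
  simp only [v] at h7
  change Z * x i = w i
  field_simp at h7
  linarith

lemma quad (a b : ℝ) (hb : 0 < b) (H : ∀ t : ℝ, 1 + a * t ^ 2 ≤ Real.exp (b * t ^ 2)) : a ≤ b := by
  by_contra hab
  push Not at hab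
  have ha : 0 < a := hb.trans hab
  set τ := (a - b) / (2 * (a * b)) with hτ
  have hτ0 : 0 < τ := by have := sub_pos.2 hab; positivity
  have h1 := H (Real.sqrt τ)
  rw [Real.sq_sqrt hτ0.le] at h1
  have h2 : a * b * τ = (a - b) / 2 := by rw [hτ]; field_simp
  have h3 := Real.add_one_le_exp (-(b * τ))
  have h4 : Real.exp (b * τ) * Real.exp (-(b * τ)) = 1 := by rw [← Real.exp_add]; simp
  have h5 : (1 + a * τ) * (1 - b * τ) ≤ 1 := by
    have : (1 + a * τ) * (1 - b * τ) ≤ (1 + a * τ) * Real.exp (-(b * τ)) := by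
      have : 0 < 1 + a * τ := by positivity
      gcongr; linarith
    have : (1 + a * τ) * Real.exp (-(b * τ)) ≤ Real.exp (b * τ) * Real.exp (-(b * τ)) := by
      gcongr
    linarith
  have h6 : (a - b) * τ ≤ (a * b * τ) * τ := by nlinarith
  rw [h2] at h6
  nlinarith [mul_pos (sub_pos.2 hab) hτ0]

lemma second (q : ℕ) (β : ℝ) (hβ : 0 < β) (x : Fin q → ℝ) (hpos : ∀ i, 0 < x i)
    (hsum : ∑ k, x k = 1)
    (F : ∀ v : Fin q → ℝ, ∑ k, x k * Real.exp (β * v k) ≤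
        Real.exp (β * (∑ k, x k * v k) + β / 2 * ∑ k, v k ^ 2))
    (i j : Fin q) (hij : i ≠ j) :
    β * (x i * x j * (x i + x j)) ≤ x i ^ 2 + x j ^ 2 := by
  let v : Fin q → ℝ := fun k => if k = i then x j else if k = j then - x i else 0
  have vi : v i = x j := by simp [v]
  have vj : v j = - x i := by simp [v, hij.symm]
  have v0 : ∀ k, k ≠ i ∧ k ≠ j → v k = 0 := fun k hk => by simp [v, hk.1, hk.2]
  have s1 : ∑ k, x k * v k = 0 := by
    rw [Fintype.sum_eq_add i j hij (fun k hk => by rw [v0 k hk]; simp), vi, vj]; ring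
  have s2 : ∑ k, v k ^ 2 = x i ^ 2 + x j ^ 2 := by
    rw [Fintype.sum_eq_add i j hij (fun k hk => by rw [v0 k hk]; simp), vi, vj]; ring
  have s3 : ∑ k, x k * v k ^ 2 = x i * x j * (x i + x j) := by
    rw [Fintype.sum_eq_add i j hij (fun k hk => by rw [v0 k hk]; simp), vi, vj]; ring
  have G1 : ∀ t : ℝ, ∑ k, x k * Real.exp (β * (t * v k)) ≤
      Real.exp (β / 2 * (x i ^ 2 + x j ^ 2) * t ^ 2) := by
    intro t
    have := F (fun k => t * v k)
    have a1 : ∑ k, x k * (t * v k) = 0 := by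
      rw [← mul_zero t, ← s1, Finset.mul_sum]
      exact Finset.sum_congr rfl fun k _ => by ring
    have a2 : ∑ k, (t * v k) ^ 2 = t ^ 2 * (x i ^ 2 + x j ^ 2) := by
      rw [← s2, Finset.mul_sum]
      exact Finset.sum_congr rfl fun k _ => by ring
    rw [a1, a2] at this
    refine this.trans (le_of_eq ?_)
    congr 1; ring
  have hi := hpos i
  have hj := hpos j
  have := quad (β ^ 2 / 2 * (x i * x j * (x i + x j))) (β / 2 * (x i ^ 2 + x j ^ 2))
    (by positivity) (by
      intro t
      have g1 := G1 t
      have g2 := G1 (-t)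
      rw [neg_sq] at g2
      have g3 : ∀ k ∈ Finset.univ, 2 * x k + (β ^ 2 * t ^ 2) * (x k * v k ^ 2) ≤
          x k * Real.exp (β * (t * v k)) + x k * Real.exp (β * (-t * v k)) := by
        intro k _
        have c := cosh_lower (β * (t * v k))
        rw [Real.cosh_eq] at c
        have d : β * (-t * v k) = -(β * (t * v k)) := by ring
        rw [d]
        have := mul_le_mul_of_nonneg_left c (hpos k).le
        nlinarith
      have g4 := Finset.sum_le_sum g3
      rw [Finset.sum_add_distrib, Finset.sum_add_distrib, ← Finset.mul_sum, ← Finset.mul_sum,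
        hsum, s3] at g4
      nlinarith)
  have h2 : 0 < β / 2 := by positivity
  refine le_of_mul_le_mul_left ?_ h2
  nlinarith

lemma numeric : (3.2 : ℝ) < Real.exp (1 / 2) + 2 * Real.exp (-(1 / 4)) := by
  have e1 := Real.exp_one_gt_d9
  have e2 := Real.exp_one_lt_d9
  set y := Real.exp (1 / 4) with hy
  have hy0 : 0 < y := Real.exp_pos _
  have h2 : Real.exp (1 / 2) = y ^ 2 := by rw [hy, ← Real.exp_nat_mul]; norm_num
  have h4 : Real.exp 1 = y ^ 4 := by rw [hy, ← Real.exp_nat_mul]; norm_num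
  rw [h4] at e1 e2
  have hi : Real.exp (-(1 / 4)) = y⁻¹ := by rw [Real.exp_neg]
  rw [h2, hi]
  have u : y < 1.2841 := by
    by_contra hc
    push Not at hc
    have : (1.2841 : ℝ) ^ 4 ≤ y ^ 4 := by gcongr
    norm_num at this e2
    linarith
  have l : 1.2839 < y := by
    by_contra hc
    push Not at hc
    have : y ^ 4 ≤ (1.2839 : ℝ) ^ 4 := by gcongr
    norm_num at this e1
    linarith
  have l2 : (1.2841 : ℝ)⁻¹ < y⁻¹ := by
    rw [inv_lt_inv₀ (by norm_num) hy0]; exact u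
  have : (0.7787 : ℝ) < (1.2841 : ℝ)⁻¹ := by norm_num
  nlinarith

lemma nonuniform (q : ℕ) (hq : 3 ≤ q) (x : Fin q → ℝ) (hc : ∀ i, x i = 1 / (q : ℝ))
    (F : ∀ v : Fin q → ℝ, ∑ k, x k * Real.exp (q * v k) ≤
        Real.exp (q * (∑ k, x k * v k) + q / 2 * ∑ k, v k ^ 2)) : False := by
  have hq3 : (3 : ℝ) ≤ q := by exact_mod_cast hq
  have hq0 : (0 : ℝ) < q := by linarith
  obtain ⟨n, rfl⟩ : ∃ n, q = n + 3 := ⟨q - 3, by omega⟩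
  set Q : ℝ := ((n + 3 : ℕ) : ℝ) with hQ
  have hn : (n : ℝ) = Q - 3 := by rw [hQ]; push_cast; ring
  have := F (Fin.cons (1 / 2 / Q) (Fin.cons (-(1 / 4) / Q) (Fin.cons (-(1 / 4) / Q) fun _ => 0)))
  simp only [hc, Fin.sum_univ_succ, Fin.cons_zero, Fin.cons_succ] at this
  have a : Q * (1 / 2 / Q) = 1 / 2 := by field_simp
  have b : Q * (-(1 / 4) / Q) = -(1 / 4) := by field_simp
  simp only [a, b, mul_zero, Real.exp_zero, Finset.sum_const, Finset.card_univ, Fintype.card_fin,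
    nsmul_eq_mul, hn] at this
  have e : Q * (1 / Q * (1 / 2 / Q) + (1 / Q * (-(1 / 4) / Q) + (1 / Q * (-(1 / 4) / Q) + 0))) +
      Q / 2 * ((1 / 2 / Q) ^ 2 + ((-(1 / 4) / Q) ^ 2 + ((-(1 / 4) / Q) ^ 2 + (Q - 3) * 0 ^ 2))) = 3 / 16 / Q := by
    field_simp; ring
  rw [e] at this
  have num := numeric
  have up : Real.exp (3 / 16 / Q) * (1 - 3 / 16 / Q) ≤ 1 := by
    have h3 := Real.add_one_le_exp (-(3 / 16 / Q))
    have h4 : Real.exp (3 / 16 / Q) * Real.exp (-(3 / 16 / Q)) = 1 := by rw [← Real.exp_add]; simp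
    rw [← h4]; gcongr; linarith
  obtain ⟨r, hr⟩ : ∃ r, r = 1 / Q := ⟨_, rfl⟩
  have hr0 : 0 < r := by rw [hr]; positivity
  have hr3 : r ≤ 1 / 3 := by rw [hr]; gcongr
  have hQr : Q * r = 1 := by rw [hr]; field_simp
  have hd : 3 / 16 / Q = 3 / 16 * r := by rw [hr]; ring
  rw [hd] at up this
  rw [← hr] at this
  set E := Real.exp (1 / 2) + 2 * Real.exp (-(1 / 4)) with hE
  have h1 : 1 + r * (E - 3) ≤ Real.exp (3 / 16 * r) := by
    refine le_trans (le_of_eq ?_) this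
    rw [hE]; linear_combination -hQr
  have h2 : (1 + r * (E - 3)) * (1 - 3 / 16 * r) ≤ 1 := by
    refine le_trans ?_ up
    gcongr
    linarith
  have h3 : (1 + r * (E - 3)) * (1 - 3 / 16 * r) - 1 =
    r * ((E - 3.2) * (1 - 3 / 16 * r) + 3 / 80 * (1 / 3 - r)) := by ring
  have h4 : 0 < (E - 3.2) * (1 - 3 / 16 * r) := mul_pos (by linarith) (by linarith)
  have h5 : 0 < r * ((E - 3.2) * (1 - 3 / 16 * r) + 3 / 80 * (1 / 3 - r)) :=
    mul_pos hr0 (by linarith)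
  linarith

/-- Properties of global minimum points of G_{β,h}: the minimal coordinate value
is attained at least q-1 times, for h > 0 the first coordinate is the strict
maximum, all coordinates are positive and the minimal coordinate is < 1/β. -/
theorem stmt_12 (q : ℕ) [NeZero q] (hq : 3 ≤ q) (β : ℝ) (hβ : 0 < β) (h : ℝ) (hh : 0 ≤ h)
    (x : Fin q → ℝ) (hx : ∀ y, G q β h x ≤ G q β h y) :
    q - 1 ≤ {i : Fin q | x i = ⨅ j, x j}.ncard ∧
    (0 < h → ∀ i : Fin q, i ≠ 0 → x i < x 0) ∧
    (0 < ⨅ j, x j) ∧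
    (⨅ j, x j) < 1 / β := by
  have hcrit := crit q β h hβ x hx
  have hkey := key0 q β h x hx
  set Z := ∑ k : Fin q, Real.exp (β * x k + if k = 0 then h else 0) with hZ
  have hZp : 0 < Z := Finset.sum_pos (fun _ _ => Real.exp_pos _) Finset.univ_nonempty
  have hpos : ∀ i, 0 < x i := fun i => by
    have := hcrit i
    have h2 := Real.exp_pos (β * x i + if i = 0 then h else 0)
    rw [← this] at h2
    exact pos_of_mul_pos_right h2 hZp.le
  have hsum : ∑ k, x k = 1 := by
    have : Z * ∑ k, x k = Z * 1 := by
      rw [Finset.mul_sum, mul_one, hZ, ← hZ]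
      exact Finset.sum_congr rfl fun k _ => hcrit k
    exact mul_left_cancel₀ hZp.ne' this
  have F : ∀ v : Fin q → ℝ, ∑ k, x k * Real.exp (β * v k) ≤
        Real.exp (β * (∑ k, x k * v k) + β / 2 * ∑ k, v k ^ 2) := by
    intro v
    refine le_of_mul_le_mul_left (le_trans (le_of_eq ?_) (hkey v)) hZp
    rw [Finset.mul_sum]
    exact Finset.sum_congr rfl fun k _ => by rw [← hcrit k]; ring
  have hsec := second q β hβ x hpos hsum F
  -- part 2
  have P2 : 0 < h → ∀ i : Fin q, i ≠ 0 → x i < x 0 := by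
    intro hp i hi
    have c0 := hcrit 0
    have ci := hcrit i
    simp only [if_true, if_neg hi, add_zero] at c0 ci
    have hsw := hx (x ∘ Equiv.swap 0 i)
    unfold G at hsw
    have e1 : ∑ k, (x ∘ Equiv.swap 0 i) k ^ 2 = ∑ k, x k ^ 2 :=
      Equiv.sum_comp (Equiv.swap 0 i) (fun k => x k ^ 2)
    rw [e1] at hsw
    have hlog : Real.log (∑ k, Real.exp (β * (x ∘ Equiv.swap 0 i) k + if k = 0 then h else 0)) ≤
      Real.log Z := by linarith
    rw [Real.log_le_log_iff (Finset.sum_pos (fun _ _ => Real.exp_pos _) Finset.univ_nonempty) hZp,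
      ← sub_nonneg, hZ, ← Finset.sum_sub_distrib, Fintype.sum_eq_add 0 i hi.symm] at hlog
    · simp only [Function.comp, Equiv.swap_apply_left, Equiv.swap_apply_right, if_true, if_neg hi,
        add_zero, Real.exp_add] at hlog
      have hE : 1 < Real.exp h := Real.one_lt_exp_iff.2 hp
      rcases lt_trichotomy (x i) (x 0) with hl | hl | hl
      · exact hl
      · exfalso
        rw [Real.exp_add, ← hl, ← ci] at c0
        have := mul_pos hZp (hpos i)
        nlinarith
      · exfalso
        have : Real.exp (β * x 0) < Real.exp (β * x i) := by
          rw [Real.exp_lt_exp]; gcongr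
        nlinarith [mul_pos (sub_pos.2 this) (sub_pos.2 hE)]
    · rintro k ⟨hk0, hki⟩
      simp [Function.comp, Equiv.swap_apply_of_ne_of_ne hk0 hki]
  obtain ⟨k, hk⟩ := exists_eq_ciInf_of_finite (f := x)
  have hmin : ∀ i, x k ≤ x i := fun i => by
    rw [hk]; exact ciInf_le (Set.finite_range x).bddBelow i
  rw [← hk]
  -- two different coordinates with the same field
  have D : ∀ i, x k < x i → (if i = 0 then h else 0) = (if k = 0 then h else 0) → 1 < β * x i := by
    intro i hi he
    have c0 := hcrit i
    have ck := hcrit k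
    rw [he] at c0
    have e : Real.exp (β * x k + if k = 0 then h else 0) =
      Real.exp (β * x i + if k = 0 then h else 0) * Real.exp (-(β * (x i - x k))) := by
      rw [← Real.exp_add]; congr 1; ring
    rw [← c0, ← ck, mul_assoc] at e
    have e' := mul_left_cancel₀ hZp.ne' e
    have l := Real.add_one_lt_exp (x := -(β * (x i - x k)))
      (by have := mul_pos hβ (sub_pos.2 hi); linarith)
    have l2 := mul_lt_mul_of_pos_left l (hpos i)
    rw [← e'] at l2
    have : 0 < (x i - x k) * (β * x i - 1) := by nlinarith
    have := pos_of_mul_pos_right this (sub_pos.2 hi).le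
    linarith
  have N : ∀ i j, i ≠ j → 1 < β * x i → 1 < β * x j → False := by
    intro i j hij hi hj
    have := hsec i j hij
    have a := hpos i
    have b := hpos j
    nlinarith [mul_pos (sub_pos.2 hi) (pow_pos b 2), mul_pos (sub_pos.2 hj) (pow_pos a 2)]
  have U : ∀ i j, i ≠ j → x k < x i → x k < x j → False := by
    have U0 : ∀ i j, i ≠ j → j ≠ 0 → x k < x i → x k < x j → False := by
      intro i j hij hj0 hi hj
      rcases hh.eq_or_lt with h0 | hp
      · exact N i j hij (D i hi (by simp [← h0])) (D j hj (by simp [← h0]))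
      · have hk0 : k ≠ 0 := by
          rintro rfl
          have := P2 hp j hj0
          linarith
        have h1 := D j hj (by simp [hj0, hk0])
        by_cases hi0 : i = 0
        · subst hi0
          refine N _ j hij ?_ h1
          have := mul_lt_mul_of_pos_left (P2 hp j hj0) hβ
          linarith
        · exact N i j hij (D i hi (by simp [hi0, hk0])) h1
    intro i j hij hi hj
    by_cases hj0 : j = 0
    · exact U0 j i hij.symm (fun h => hij (h.trans hj0.symm)) hj hi
    · exact U0 i j hij hj0 hi hj
  refine ⟨?_, P2, hpos k, ?_⟩
  · have hcompl : ({i : Fin q | x i = x k}ᶜ).ncard ≤ 1 := by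
      rw [Set.ncard_le_one]
      intro a ha b hb
      by_contra hab
      exact U a b hab (lt_of_le_of_ne (hmin a) (Ne.symm ha)) (lt_of_le_of_ne (hmin b) (Ne.symm hb))
    have := Set.ncard_add_ncard_compl {i : Fin q | x i = x k}
    rw [Nat.card_eq_fintype_card, Fintype.card_fin] at this
    omega
  · by_contra hcon
    push Not at hcon
    have hge : ∀ i, 1 ≤ β * x i := fun i => by
      have := hcon.trans (hmin i)
      rw [div_le_iff₀ hβ] at this
      linarith
    have heq : ∀ i, β * x i = 1 := by
      intro i
      have : Nontrivial (Fin q) := Fin.nontrivial_iff_two_le.2 (by omega)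
      obtain ⟨j, hj⟩ := exists_ne i
      have s := hsec i j hj.symm
      have a := hpos i
      have b := hpos j
      by_contra hne
      have hgt : 1 < β * x i := lt_of_le_of_ne (hge i) (Ne.symm hne)
      nlinarith [mul_pos (sub_pos.2 hgt) (pow_pos b 2),
        mul_nonneg (sub_nonneg.2 (hge j)) (pow_pos a 2).le]
    have hβq : β = q := by
      have : β * ∑ k, x k = q := by
        rw [Finset.mul_sum, Finset.sum_congr rfl fun k _ => heq k]; simp
      rw [hsum] at this; linarith
    subst hβq
    exact nonuniform q hq x (fun i => by rw [eq_div_iff hβ.ne', mul_comm]; exact heq i) F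

end CWP
end
end
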